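/- Let A be a unital complex *-algebra and z₁,z₂,z₃,z₄ ∈ A arbitrary elements. For every w in the special unitary group SU(2) of 2×2 complex matrices, let u·w denote the 4×2 matrix over A with entries (u·w)_{ia} = Σ_b w_{ba} • u_{ib} (scalar action of the complex entries of w). Then (u·w)(u·w)* = u u*. Hence the projection 𝗊 = u u* defining the noncommutative Hopf fibration A(S⁴_θ) ↪ A(S⁷_θ) is invariant under the right SU(2)-action, which therefore survives the deformation. -/

import Mathlib

open Matrix

/-- The 4×2 matrix `u` over `A` with first column `(z₁,z₂,z₃,z₄)ᵗ` and second column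
`(−z₂*, z₁*, −z₄*, z₃*)ᵗ`. -/
def umat {A : Type*} [Ring A] [StarRing A] (z : Fin 4 → A) : Matrix (Fin 4) (Fin 2) A :=
  !![z 0, -star (z 1); z 1, star (z 0); z 2, -star (z 3); z 3, star (z 2)]

/-- Multiplying on the right by a scalar unitary matrix does not change `M * Mᴴ`. -/
theorem mul_map_algebraMap_mul_conjTranspose {R A m n : Type*} [CommRing R] [StarRing R]
    [Ring A] [Algebra R A] [StarRing A] [StarModule R A] [Fintype n] [DecidableEq n]
    (M : Matrix m n A) {w : Matrix n n R} (hw : w ∈ Matrix.unitaryGroup n R) :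
    (M * w.map (algebraMap R A)) * (M * w.map (algebraMap R A))ᴴ = M * Mᴴ := by
  have hstar : (w.map (algebraMap R A))ᴴ = wᴴ.map (algebraMap R A) :=
    (Matrix.conjTranspose_map _ fun r => algebraMap_star_comm r).symm
  have hunit : w * wᴴ = 1 := Matrix.mem_unitaryGroup_iff.mp hw
  rw [Matrix.conjTranspose_mul, hstar, Matrix.mul_assoc,
    ← Matrix.mul_assoc (w.map _), ← Matrix.map_mul, hunit,
    Matrix.map_one _ (map_zero _) (map_one _), Matrix.one_mul]

/-- For arbitrary elements `z₁,…,z₄` of a unital complex *-algebra `A`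
and every `w ∈ SU(2)`, the matrix `u·w` (with `(u·w)_{ia} = Σ_b w_{ba} • u_{ib}`) satisfies
`(u·w)(u·w)* = u u*`; hence the projection `𝗊 = u u*` defining the noncommutative Hopf
fibration is invariant under the right `SU(2)`-action. -/
theorem stmt15 {A : Type*} [Ring A] [Algebra ℂ A] [StarRing A] [StarModule ℂ A]
    (z : Fin 4 → A) (w : Matrix.specialUnitaryGroup (Fin 2) ℂ) :
    let uw : Matrix (Fin 4) (Fin 2) A :=
      Matrix.of fun i a => ∑ b, (w : Matrix (Fin 2) (Fin 2) ℂ) b a • umat z i b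
    uw * uwᴴ = umat z * (umat z)ᴴ := by
  intro uw
  have huw : uw = umat z * (w : Matrix (Fin 2) (Fin 2) ℂ).map (algebraMap ℂ A) := by
    ext i a
    simp only [uw, Matrix.of_apply, Matrix.mul_apply, Matrix.map_apply, Algebra.smul_def,
      Algebra.commutes]
  rw [huw]
  exact mul_map_algebraMap_mul_conjTranspose _ (Matrix.mem_specialUnitaryGroup_iff.mp w.2).1
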